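/- For every natural numbers n and k, the number of triples (Γ₁,Γ₂,Γ₃) ⊢ [n,n+1,n+2] with pos_∞(Γ₁,Γ₂,Γ₃) = k equals the number of triples (Γ₁,Γ₂,Γ₃) ⊢ [n,n+1,n+2] with pos_{1+}(Γ₁,Γ₂,Γ₃) = k; equivalently ∑_{Γ⊢[n,n+1,n+2]} q^{pos_∞(Γ)} = ∑_{Γ⊢[n,n+1,n+2]} q^{pos_{1+}(Γ)} as polynomials in q. -/

import Mathlib

/-!
Statement 4: for all n, k, the number of triples (Γ₁,Γ₂,Γ₃) ⊢ [n,n+1,n+2] with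
pos_∞ = k equals the number of triples with pos_{1+} = k.
-/

/-- The number of nonempty columns of a Young diagram. -/
def ell (Γ : YoungDiagram) : ℕ := (Γ.cells.filter fun c => c.2 = 0).card

/-- The hook difference of a box `c` with respect to a finite set `s` of boxes. -/
def hookDiff (s : Finset (ℕ × ℕ)) (c : ℕ × ℕ) : ℤ :=
  ((s.filter fun d => d.2 = c.2 ∧ c.1 < d.1).card : ℤ)
    - ((s.filter fun d => d.1 = c.1 ∧ c.2 < d.2).card : ℤ)

/-- `pos_{1+}` of a triple of nested Young diagrams, given the cells `s₁` of `Γ₁`,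
the cells `s₂` of `Γ₂`, the box `b₁` of `Γ₂ ∖ Γ₁` and the box `b₂` of `Γ₃ ∖ Γ₂`. -/
def posOne (s₁ s₂ : Finset (ℕ × ℕ)) (b₁ b₂ : ℕ × ℕ) : ℕ :=
  (s₁.filter fun c => hookDiff s₁ c ≠ 0 ∧ hookDiff s₁ c ≠ 1).card
    + (s₁.filter fun c =>
        (hookDiff s₁ c = 0 ∧ c.1 = b₁.1) ∨ (hookDiff s₁ c = 1 ∧ c.2 = b₁.2)).card
    + (s₂.filter fun c =>
        (hookDiff s₂ c = 0 ∧ c.1 = b₂.1) ∨ (hookDiff s₂ c = 1 ∧ c.2 = b₂.2)).card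
    + (if b₁.1 + b₁.2 + 2 < b₂.1 + b₂.2
          ∨ (b₂.1 + b₂.2 = b₁.1 + b₁.2 + 2 ∧ b₁.2 < b₂.2) then 1 else 0)

/-- A triple of nested Young diagrams `(Γ₁,Γ₂,Γ₃) ⊢ [n,n+1,n+2]`, recorded together with
the (uniquely determined) added boxes `b₁ ∈ Γ₂ ∖ Γ₁` and `b₂ ∈ Γ₃ ∖ Γ₂`. -/
structure TripleFlag (n : ℕ) where
  Γ₁ : YoungDiagram
  Γ₂ : YoungDiagram
  Γ₃ : YoungDiagram
  b₁ : ℕ × ℕ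
  b₂ : ℕ × ℕ
  card₁ : Γ₁.card = n
  not_mem₁ : b₁ ∉ Γ₁
  cells₂ : Γ₂.cells = insert b₁ Γ₁.cells
  not_mem₂ : b₂ ∉ Γ₂
  cells₃ : Γ₃.cells = insert b₂ Γ₂.cells

/-- `pos_∞` of a triple: `(n+2) − ℓ(Γ₃) + 1` if `v₂ ≥ v₁ + 2`, and `(n+2) − ℓ(Γ₃)`
otherwise. -/
def posInf {n : ℕ} (T : TripleFlag n) : ℕ :=
  if T.b₁.2 + 2 ≤ T.b₂.2 then (n + 2) - ell T.Γ₃ + 1 else (n + 2) - ell T.Γ₃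

section Helpers

open Finset
open Polynomial

/-- Down-closed finite sets of boxes. -/
def Low (s : Finset (ℕ × ℕ)) : Prop :=
  ∀ u v u' v' : ℕ, (u, v) ∈ s → u' ≤ u → v' ≤ v → (u', v') ∈ s

/-- Removable boxes. -/
def remS (s : Finset (ℕ × ℕ)) : Finset (ℕ × ℕ) :=
  s.filter fun b => (b.1 + 1, b.2) ∉ s ∧ (b.1, b.2 + 1) ∉ s

/-- Addable boxes. -/
def addS (s : Finset (ℕ × ℕ)) : Finset (ℕ × ℕ) :=
  ((range (s.card + 1)) ×ˢ (range (s.card + 1))).filter fun b =>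
    b ∉ s ∧ (b.1 = 0 ∨ (b.1 - 1, b.2) ∈ s) ∧ (b.2 = 0 ∨ (b.1, b.2 - 1) ∈ s)

/-- The upper right corner of a box. -/
def shiftB (b : ℕ × ℕ) : ℕ × ℕ := (b.1 + 1, b.2 + 1)

lemma Low.lt_card {s : Finset (ℕ × ℕ)} (hs : Low s) {u v : ℕ} (h : (u, v) ∈ s) :
    u < s.card ∧ v < s.card := by
  constructor
  · have : ((range (u + 1)).image fun i => (i, v)) ⊆ s := by
      intro x hx
      simp only [mem_image, mem_range] at hx
      obtain ⟨i, hi, rfl⟩ := hx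
      exact hs u v i v h (by omega) le_rfl
    have h2 := card_le_card this
    rw [card_image_of_injective _ (fun a b h => by simpa using h), card_range] at h2
    omega
  · have : ((range (v + 1)).image fun i => (u, i)) ⊆ s := by
      intro x hx
      simp only [mem_image, mem_range] at hx
      obtain ⟨i, hi, rfl⟩ := hx
      exact hs u v u i h le_rfl (by omega)
    have h2 := card_le_card this
    rw [card_image_of_injective _ (fun a b h => by simpa using h), card_range] at h2
    omega

lemma mem_remS {s : Finset (ℕ × ℕ)} {b : ℕ × ℕ} :
    b ∈ remS s ↔ b ∈ s ∧ (b.1 + 1, b.2) ∉ s ∧ (b.1, b.2 + 1) ∉ s := by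
  simp [remS]

lemma mem_addS {s : Finset (ℕ × ℕ)} (hs : Low s) {b : ℕ × ℕ} :
    b ∈ addS s ↔ b ∉ s ∧ (b.1 = 0 ∨ (b.1 - 1, b.2) ∈ s) ∧ (b.2 = 0 ∨ (b.1, b.2 - 1) ∈ s) := by
  simp only [addS, mem_filter, mem_product, mem_range, and_iff_right_iff_imp]
  rintro ⟨h0, h1, h2⟩
  constructor
  · rcases h1 with h1 | h1
    · omega
    · have := (hs.lt_card h1).1; omega
  · rcases h2 with h1 | h1
    · omega
    · have := (hs.lt_card h1).2; omega

/-- Column heights and row lengths. -/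
lemma Low.exists_lens {s : Finset (ℕ × ℕ)} (hs : Low s) :
    ∃ c r : ℕ → ℕ, (∀ u v, (u, v) ∈ s ↔ v < c u) ∧ (∀ u v, (u, v) ∈ s ↔ u < r v) := by
  let μ : YoungDiagram := ⟨s, by
    rintro ⟨a, b⟩ ⟨a', b'⟩ h hm
    exact hs a b a' b' hm h.1 h.2⟩
  refine ⟨μ.rowLen, μ.colLen, fun u v => ?_, fun u v => ?_⟩
  · rw [← YoungDiagram.mem_iff_lt_rowLen]; rfl
  · rw [← YoungDiagram.mem_iff_lt_colLen]; rfl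

/-- The sequence of corners as a walk. -/
lemma walk {K : Type*} [LinearOrder K] (κ κ' : ℕ × ℕ → K) (e f : ℕ × ℕ → ℕ) :
    ∀ (n : ℕ) (V P : Finset (ℕ × ℕ)), V.card + P.card = n →
      (∀ x ∈ V, ∀ y ∈ V, κ x = κ y → x = y) → (∀ x ∈ P, ∀ y ∈ P, κ' x = κ' y → x = y) →
      (∀ x ∈ V, ∀ y ∈ P, κ x ≠ κ' y) →
      (∀ x ∈ V, e x + #{y ∈ V | κ x < κ y} = #{y ∈ P | κ x < κ' y}) →
      (∀ x ∈ P, f x + #{y ∈ V | κ' x < κ y} = #{y ∈ P | κ' x < κ' y}) →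
      ∀ k : ℕ, k + V.card = P.card + 1 →
        V.val.map e + Multiset.range k = 0 ::ₘ P.val.map (fun x => f x + 1) := by
  intro n
  induction n with
  | zero =>
    intro V P h _ _ _ _ _ k hk
    have hV : V = ∅ := by rw [← card_eq_zero]; omega
    have hP : P = ∅ := by rw [← card_eq_zero]; omega
    subst hV hP
    have : k = 1 := by simpa using hk
    subst this; rfl
  | succ n ih =>
    intro V P h iV iP iVP hV hP k hk
    have hne : (V.disjSum P).Nonempty := by
      rw [← card_pos, card_disjSum]; omega
    obtain ⟨a, ha, hmin⟩ := exists_min_image (V.disjSum P) (Sum.elim κ κ') hne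
    have hminV : ∀ y ∈ V, Sum.elim κ κ' a ≤ κ y := fun y hy =>
      hmin (Sum.inl y) (inl_mem_disjSum.2 hy)
    have hminP : ∀ y ∈ P, Sum.elim κ κ' a ≤ κ' y := fun y hy =>
      hmin (Sum.inr y) (inr_mem_disjSum.2 hy)
    rcases a with a | a
    · have ha' : a ∈ V := inl_mem_disjSum.1 ha
      simp only [Sum.elim_inl] at hminV hminP
      have h1 := hV a ha'
      have e1 : ({y ∈ V | κ a < κ y} : Finset _) = V.erase a := by
        ext y
        simp only [mem_filter, mem_erase]
        constructor
        · rintro ⟨h1, h2⟩; exact ⟨fun h => by subst h; exact lt_irrefl _ h2, h1⟩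
        · rintro ⟨h1, h2⟩; exact ⟨h2, lt_of_le_of_ne (hminV y h2) fun h => h1 (iV a ha' y h2 h).symm⟩
      have e2 : ({y ∈ P | κ a < κ' y} : Finset _) = P := by
        rw [filter_eq_self]
        intro y hy
        exact lt_of_le_of_ne (hminP y hy) (iVP a ha' y hy)
      have hc := card_erase_add_one ha'
      rw [e1, e2] at h1
      have key : ∀ z, κ a ≤ z → ({y ∈ V.erase a | z < κ y} : Finset _) = {y ∈ V | z < κ y} := by
        intro z hz
        ext y
        simp only [mem_filter, mem_erase]
        constructor
        · rintro ⟨⟨_, h⟩, h'⟩; exact ⟨h, h'⟩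
        · rintro ⟨h, h'⟩; exact ⟨⟨fun h => by subst h; exact absurd h' (not_lt.2 hz), h⟩, h'⟩
      have := ih (V.erase a) P (by omega)
        (fun x hx y hy => iV x (mem_of_mem_erase hx) y (mem_of_mem_erase hy)) iP
        (fun x hx => iVP x (mem_of_mem_erase hx))
        (fun x hx => by rw [key _ (hminV x (mem_of_mem_erase hx))]; exact hV x (mem_of_mem_erase hx))
        (fun x hx => by rw [key _ (hminP x hx)]; exact hP x hx)
        (k + 1) (by omega)
      rw [← this]
      have hk : k = e a := by omega
      rw [← insert_erase ha', insert_val_of_notMem (notMem_erase a V), Multiset.map_cons,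
        erase_insert (notMem_erase a V),
        Multiset.range_succ, ← hk]
      simp
    · have ha' : a ∈ P := inr_mem_disjSum.1 ha
      simp only [Sum.elim_inr] at hminV hminP
      have h1 := hP a ha'
      have e1 : ({y ∈ P | κ' a < κ' y} : Finset _) = P.erase a := by
        ext y
        simp only [mem_filter, mem_erase]
        constructor
        · rintro ⟨h1, h2⟩; exact ⟨fun h => by subst h; exact lt_irrefl _ h2, h1⟩
        · rintro ⟨h1, h2⟩; exact ⟨h2, lt_of_le_of_ne (hminP y h2) fun h => h1 (iP a ha' y h2 h).symm⟩
      have e2 : ({y ∈ V | κ' a < κ y} : Finset _) = V := by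
        rw [filter_eq_self]
        intro y hy
        exact lt_of_le_of_ne (hminV y hy) (iVP y hy a ha').symm
      have hc := card_erase_add_one ha'
      rw [e1, e2] at h1
      have key : ∀ z, κ' a ≤ z → ({y ∈ P.erase a | z < κ' y} : Finset _) = {y ∈ P | z < κ' y} := by
        intro z hz
        ext y
        simp only [mem_filter, mem_erase]
        constructor
        · rintro ⟨⟨_, h⟩, h'⟩; exact ⟨h, h'⟩
        · rintro ⟨h, h'⟩; exact ⟨⟨fun h => by subst h; exact absurd h' (not_lt.2 hz), h⟩, h'⟩
      have := ih V (P.erase a) (by omega) iV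
        (fun x hx y hy => iP x (mem_of_mem_erase hx) y (mem_of_mem_erase hy))
        (fun x hx y hy => iVP x hx y (mem_of_mem_erase hy))
        (fun x hx => by rw [key _ (hminV x hx)]; exact hV x hx)
        (fun x hx => by rw [key _ (hminP x (mem_of_mem_erase hx))]; exact hP x (mem_of_mem_erase hx))
        (f a + 1) (by omega)
      have hk : k = f a + 1 + 1 := by omega
      have e3 : P.val.map (fun x => f x + 1)
          = (f a + 1) ::ₘ (P.erase a).val.map (fun x => f x + 1) := by
        conv_lhs => rw [← insert_erase ha', insert_val_of_notMem (notMem_erase a P),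
          Multiset.map_cons]
      rw [e3, Multiset.cons_swap, ← this, hk, Multiset.range_succ]
      simp

/-- Telescoping along rows. -/
lemma tele_aux {s : Finset (ℕ × ℕ)} (hs : Low s) {c r : ℕ → ℕ}
    (hc : ∀ u v, (u, v) ∈ s ↔ v < c u) (hr : ∀ u v, (u, v) ∈ s ↔ u < r v)
    (φ : ℕ × ℕ → ℤ) (W : ℕ) (hW : c 0 ≤ W) :
    ∑ b ∈ remS s, φ (shiftB b) - ∑ x ∈ addS s, φ x
      = ∑ w ∈ range W, (φ (r w, w + 1) - φ (r w, w)) - φ (0, W) := by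
  have ha : ∀ w, r (w + 1) ≤ r w := by
    intro w
    by_contra h
    push Not at h
    have h1 := (hr (r w) (w + 1)).2 h
    have h2 := hs _ _ (r w) w h1 le_rfl (by omega)
    rw [hr] at h2; omega
  have h0 : ∀ w, W ≤ w → r w = 0 := by
    intro w hw
    by_contra h
    have := (hr 0 w).2 (by omega)
    rw [hc] at this; omega
  have hrem : ∑ b ∈ remS s, φ (shiftB b)
      = ∑ w ∈ (range W).filter (fun w => r (w + 1) < r w), φ (r w, w + 1) := by
    refine sum_bij' (fun b _ => b.2) (fun w _ => (r w - 1, w)) ?_ ?_ ?_ ?_ ?_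
    · rintro ⟨u, v⟩ hb
      rw [mem_remS] at hb
      simp only [hr] at hb
      simp only [mem_filter, mem_range]
      refine ⟨?_, by omega⟩
      by_contra h
      have := h0 v (by omega); omega
    · intro w hw
      simp only [mem_filter, mem_range] at hw
      rw [mem_remS]
      simp only [hr]
      omega
    · rintro ⟨u, v⟩ hb
      rw [mem_remS] at hb
      simp only [hr] at hb
      simp only [Prod.mk.injEq, and_true]; omega
    · intro w hw; rfl
    · rintro ⟨u, v⟩ hb
      rw [mem_remS] at hb
      simp only [hr] at hb
      have : r v = u + 1 := by omega
      simp [shiftB, this]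
  have hadd : ∑ x ∈ addS s, φ x
      = φ (r 0, 0) + ∑ w ∈ (range W).filter (fun w => r (w + 1) < r w), φ (r (w + 1), w + 1) := by
    have hx : (r 0, 0) ∈ addS s := by
      rw [mem_addS hs]
      simp only [hr]; exact ⟨by omega, by omega, Or.inl trivial⟩
    rw [← add_sum_erase _ _ hx]
    congr 1
    refine sum_bij' (fun b _ => b.2 - 1) (fun w _ => (r (w + 1), w + 1)) ?_ ?_ ?_ ?_ ?_
    · rintro ⟨u, v⟩ hb
      rw [mem_erase, mem_addS hs] at hb
      simp only [hr, ne_eq, Prod.mk.injEq, not_and] at hb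
      simp only [mem_filter, mem_range]
      have hv : v ≠ 0 := by
        intro hv; subst hv; omega
      obtain ⟨w, rfl⟩ := Nat.exists_eq_succ_of_ne_zero hv
      simp only [Nat.succ_eq_add_one, Nat.add_sub_cancel] at *
      refine ⟨?_, by omega⟩
      by_contra h
      have := h0 w (by omega); omega
    · intro w hw
      simp only [mem_filter, mem_range] at hw
      rw [mem_erase, mem_addS hs]
      simp only [hr, ne_eq, Prod.mk.injEq, Nat.add_sub_cancel]
      omega
    · rintro ⟨u, v⟩ hb
      rw [mem_erase, mem_addS hs] at hb
      simp only [hr, ne_eq, Prod.mk.injEq, not_and] at hb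
      have hv : v ≠ 0 := by
        intro hv; subst hv; omega
      obtain ⟨w, rfl⟩ := Nat.exists_eq_succ_of_ne_zero hv
      simp only [Nat.succ_eq_add_one, Nat.add_sub_cancel, Prod.mk.injEq, and_true] at *
      omega
    · intro w hw; simp
    · rintro ⟨u, v⟩ hb
      rw [mem_erase, mem_addS hs] at hb
      simp only [hr, ne_eq, Prod.mk.injEq, not_and] at hb
      have hv : v ≠ 0 := by
        intro hv; subst hv; omega
      obtain ⟨w, rfl⟩ := Nat.exists_eq_succ_of_ne_zero hv
      simp only [Nat.succ_eq_add_one, Nat.add_sub_cancel] at *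
      have : r (w + 1) = u := by omega
      rw [this]
  rw [hrem, hadd, sub_add_eq_sub_sub, sub_right_comm, ← sum_sub_distrib, sum_filter]
  have : ∀ w ∈ range W, (if r (w + 1) < r w then φ (r w, w + 1) - φ (r (w + 1), w + 1) else 0)
      = φ (r w, w + 1) - φ (r (w + 1), w + 1) := by
    intro w _
    split_ifs with h
    · rfl
    · have : r (w + 1) = r w := le_antisymm (ha w) (by omega)
      rw [this]; simp
  rw [sum_congr rfl this]
  have e1 : φ (0, W) = φ (r W, W) := by rw [h0 W le_rfl]
  rw [e1, sum_sub_distrib, sum_sub_distrib]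
  have := sum_range_succ' (fun w => φ (r w, w)) W
  rw [sum_range_succ] at this
  linarith

/-- Telescoping along columns. -/
lemma tele_aux' {s : Finset (ℕ × ℕ)} (hs : Low s) {c r : ℕ → ℕ}
    (hc : ∀ u v, (u, v) ∈ s ↔ v < c u) (hr : ∀ u v, (u, v) ∈ s ↔ u < r v)
    (φ : ℕ × ℕ → ℤ) (W : ℕ) (hW : r 0 ≤ W) :
    ∑ b ∈ remS s, φ (shiftB b) - ∑ x ∈ addS s, φ x
      = ∑ w ∈ range W, (φ (w + 1, c w) - φ (w, c w)) - φ (W, 0) := by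
  have hmem : ∀ x : ℕ × ℕ, x ∈ s.image Prod.swap ↔ x.swap ∈ s := by
    intro x
    simp only [mem_image]
    constructor
    · rintro ⟨y, hy, rfl⟩; simpa using hy
    · intro h; exact ⟨x.swap, h, by simp⟩
  have hs' : Low (s.image Prod.swap) := by
    intro u v u' v' h h1 h2
    rw [hmem] at h ⊢
    exact hs v u v' u' h h2 h1
  have := tele_aux (s := s.image Prod.swap) hs' (c := r) (r := c)
    (fun u v => by rw [hmem]; exact hr v u) (fun u v => by rw [hmem]; exact hc v u)
    (fun x => φ x.swap) W hW
  simp only [Prod.swap_prod_mk] at this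
  rw [← this]
  congr 1
  · refine sum_bij' (fun b _ => b.swap) (fun b _ => b.swap) ?_ ?_ ?_ ?_ ?_
    · rintro ⟨u, v⟩ hb
      rw [mem_remS] at hb ⊢
      simp only [hmem, Prod.swap_prod_mk, Prod.fst_swap, Prod.snd_swap] at hb ⊢
      tauto
    · rintro ⟨u, v⟩ hb
      rw [mem_remS] at hb ⊢
      simp only [hmem, Prod.swap_prod_mk, Prod.fst_swap, Prod.snd_swap] at hb ⊢
      tauto
    · intro _ _; simp
    · intro _ _; simp
    · intro _ _; simp [shiftB]
  · refine sum_bij' (fun b _ => b.swap) (fun b _ => b.swap) ?_ ?_ ?_ ?_ ?_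
    · rintro ⟨u, v⟩ hb
      rw [mem_addS hs] at hb
      rw [mem_addS hs']
      simp only [hmem, Prod.swap_prod_mk, Prod.fst_swap, Prod.snd_swap] at hb ⊢
      tauto
    · rintro ⟨u, v⟩ hb
      rw [mem_addS hs'] at hb
      rw [mem_addS hs]
      simp only [hmem, Prod.swap_prod_mk, Prod.fst_swap, Prod.snd_swap] at hb ⊢
      tauto
    · intro _ _; simp
    · intro _ _; simp
    · intro _ _; simp

lemma card_addS {s : Finset (ℕ × ℕ)} (hs : Low s) : (addS s).card = (remS s).card + 1 := by
  obtain ⟨c, r, hc, hr⟩ := hs.exists_lens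
  have := tele_aux hs hc hr (fun _ => 1) (c 0) le_rfl
  simp at this
  omega

lemma add_ne_rem {s : Finset (ℕ × ℕ)} (hs : Low s) {x y : ℕ × ℕ} (hx : x ∈ addS s)
    (hy : y ∈ remS s) : x ≠ shiftB y := by
  rintro rfl
  rw [mem_addS hs] at hx
  rw [mem_remS] at hy
  simp [shiftB] at hx
  tauto

lemma remS_nonempty {s : Finset (ℕ × ℕ)} (h : s.Nonempty) : (remS s).Nonempty := by
  obtain ⟨b, hb, hmax⟩ := exists_max_image s (fun b => b.1 + b.2) h
  refine ⟨b, mem_remS.2 ⟨hb, fun h => ?_, fun h => ?_⟩⟩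
  · have := hmax _ h; simp at this
  · have := hmax _ h; simp at this


/-- A statistic on partitions together with corner weights. -/
structure Sys where
  κ : ℕ × ℕ → ℕ ×ₗ ℕ
  w : Finset (ℕ × ℕ) → ℕ
  e : Finset (ℕ × ℕ) → ℕ × ℕ → ℕ
  f : Finset (ℕ × ℕ) → ℕ × ℕ → ℕ
  inj : Function.Injective κ
  H0 : w ∅ = 0
  H3 : ∀ s, Low s → ∀ B ⊆ remS s,
    w s + ∑ b ∈ B, f s b = w (s \ B) + ∑ b ∈ B, e (s \ B) b
  HV : ∀ s, Low s → ∀ x ∈ addS s,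
    e s x + #{y ∈ addS s | κ x < κ y} = #{y ∈ remS s | κ x < κ (shiftB y)}
  HP : ∀ s, Low s → ∀ x ∈ remS s,
    f s x + #{y ∈ addS s | κ (shiftB x) < κ y} = #{y ∈ remS s | κ (shiftB x) < κ (shiftB y)}

lemma shiftB_inj : Function.Injective shiftB := by
  rintro ⟨a, b⟩ ⟨c, d⟩ h
  simpa [shiftB] using h

lemma Sys.H2 (S : Sys) {s : Finset (ℕ × ℕ)} (hs : Low s) :
    (addS s).val.map (S.e s) = 0 ::ₘ (remS s).val.map (fun b => S.f s b + 1) := by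
  have := walk S.κ (fun b => S.κ (shiftB b)) (S.e s) (S.f s) _ (addS s) (remS s) rfl
    (fun x _ y _ h => S.inj h) (fun x _ y _ h => shiftB_inj (S.inj h))
    (fun x hx y hy h => add_ne_rem hs hx hy (S.inj h))
    (S.HV s hs) (S.HP s hs) 0 (by rw [card_addS hs]; omega)
  simpa using this

lemma Sys.upper (S : Sys) {s : Finset (ℕ × ℕ)} (hs : Low s) {b : ℕ × ℕ} (hb : b ∈ remS s) :
    ({y ∈ addS s | S.κ (shiftB b) < S.κ y} : Finset _).val.map (S.e s)
        + Multiset.range (S.f s b + 1)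
      = 0 ::ₘ ({y ∈ remS s | S.κ (shiftB b) < S.κ (shiftB y)} : Finset _).val.map
          (fun b => S.f s b + 1) := by
  have k1 : ∀ z, S.κ (shiftB b) < z →
      ({y ∈ ({y ∈ addS s | S.κ (shiftB b) < S.κ y} : Finset _) | z < S.κ y} : Finset _)
        = {y ∈ addS s | z < S.κ y} := by
    intro z hz
    ext y
    simp only [mem_filter]
    constructor
    · rintro ⟨⟨h, _⟩, h'⟩; exact ⟨h, h'⟩
    · rintro ⟨h, h'⟩; exact ⟨⟨h, hz.trans h'⟩, h'⟩
  have k2 : ∀ z, S.κ (shiftB b) < z →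
      ({y ∈ ({y ∈ remS s | S.κ (shiftB b) < S.κ (shiftB y)} : Finset _) |
          z < S.κ (shiftB y)} : Finset _)
        = {y ∈ remS s | z < S.κ (shiftB y)} := by
    intro z hz
    ext y
    simp only [mem_filter]
    constructor
    · rintro ⟨⟨h, _⟩, h'⟩; exact ⟨h, h'⟩
    · rintro ⟨h, h'⟩; exact ⟨⟨h, hz.trans h'⟩, h'⟩
  refine walk S.κ (fun b => S.κ (shiftB b)) (S.e s) (S.f s) _ _ _ rfl
    (fun x _ y _ h => S.inj h) (fun x _ y _ h => shiftB_inj (S.inj h))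
    (fun x hx y hy h => add_ne_rem hs (mem_filter.1 hx).1 (mem_filter.1 hy).1 (S.inj h))
    ?_ ?_ _ ?_
  · intro x hx
    rw [k1 _ (mem_filter.1 hx).2, k2 _ (mem_filter.1 hx).2]
    exact S.HV s hs x (mem_filter.1 hx).1
  · intro x hx
    rw [k1 _ (mem_filter.1 hx).2, k2 _ (mem_filter.1 hx).2]
    exact S.HP s hs x (mem_filter.1 hx).1
  · have := S.HP s hs b hb
    omega

lemma sum_addS (S : Sys) {s : Finset (ℕ × ℕ)} (hs : Low s) :
    ∑ x ∈ addS s, (X : ℤ[X]) ^ S.e s x = 1 + X * ∑ b ∈ remS s, X ^ S.f s b := by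
  have := congrArg (fun m => (m.map (fun i => (X : ℤ[X]) ^ i)).sum) (S.H2 hs)
  simp only [Multiset.map_map, Multiset.map_cons, Multiset.sum_cons, pow_zero,
    Function.comp_def] at this
  rw [mul_sum]
  simp only [← pow_succ']
  exact this

lemma sum_upper (S : Sys) {s : Finset (ℕ × ℕ)} (hs : Low s) {b : ℕ × ℕ} (hb : b ∈ remS s) :
    ∑ x ∈ addS s with S.κ (shiftB b) < S.κ x, (X : ℤ[X]) ^ S.e s x
        + ∑ i ∈ range (S.f s b + 1), X ^ i
      = 1 + X * ∑ y ∈ remS s with S.κ (shiftB b) < S.κ (shiftB y), X ^ S.f s y := by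
  have := congrArg (fun m => (m.map (fun i => (X : ℤ[X]) ^ i)).sum) (S.upper hs hb)
  simp only [Multiset.map_map, Multiset.map_cons, Multiset.sum_cons, pow_zero,
    Function.comp_def, Multiset.map_add, Multiset.sum_add] at this
  rw [mul_sum]
  simp only [← pow_succ']
  exact this

/-- Elementary symmetric functions of corner weights. -/
noncomputable def Sys.F (S : Sys) (s : Finset (ℕ × ℕ)) (k : ℕ) : ℤ[X] :=
  ∑ B ∈ powersetCard k (remS s), ∏ b ∈ B, X ^ S.f s b

noncomputable def Sys.G (S : Sys) (s : Finset (ℕ × ℕ)) (k : ℕ) : ℤ[X] :=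
  ∑ B ∈ powersetCard k (addS s), ∏ b ∈ B, X ^ S.e s b

lemma newton2 (P : Finset (ℕ × ℕ)) (g : ℕ × ℕ → ℤ[X]) :
    (∑ b ∈ P, g b) ^ 2 = ∑ b ∈ P, g b ^ 2 + 2 * ∑ B ∈ powersetCard 2 P, ∏ b ∈ B, g b := by
  induction P using Finset.induction_on with
  | empty => rw [powersetCard_eq_empty.2 (by simp)]; simp
  | insert a P ha ih =>
    rw [sum_insert ha, sum_insert ha, powersetCard_succ_insert ha, sum_union, sum_image]
    · have : ∑ x ∈ powersetCard 1 P, ∏ b ∈ insert a x, g b = g a * ∑ b ∈ P, g b := by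
        rw [powersetCard_one, sum_map, mul_sum]
        refine sum_congr rfl fun b hb => ?_
        have : a ≠ b := fun h => ha (h ▸ hb)
        simp [prod_pair this]
      rw [this]
      linear_combination ih
    · intro x hx y hy h
      have hx' : a ∉ x := fun h => ha ((mem_powersetCard.1 hx).1 h)
      have hy' : a ∉ y := fun h => ha ((mem_powersetCard.1 hy).1 h)
      rw [← erase_insert hx', ← erase_insert hy', h]
    · rw [disjoint_left]
      intro x hx hy
      obtain ⟨y, hy, rfl⟩ := mem_image.1 hy
      exact ha ((mem_powersetCard.1 hx).1 (mem_insert_self _ _))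

lemma pairs_eq (κ : ℕ × ℕ → ℕ ×ₗ ℕ) (hκ : Function.Injective κ) (P : Finset (ℕ × ℕ))
    (g : ℕ × ℕ → ℤ[X]) :
    ∑ b ∈ P, g b * ∑ y ∈ P with κ b < κ y, g y
      = ∑ B ∈ powersetCard 2 P, ∏ b ∈ B, g b := by
  have h1 : (∑ b ∈ P, g b) ^ 2 = ∑ b ∈ P, ∑ y ∈ P, (if κ b < κ y then g b * g y else 0)
      + ∑ b ∈ P, ∑ y ∈ P, (if κ y < κ b then g b * g y else 0)
      + ∑ b ∈ P, ∑ y ∈ P, (if b = y then g b * g y else 0) := by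
    rw [← sum_add_distrib, ← sum_add_distrib, sq, sum_mul_sum]
    refine sum_congr rfl fun b _ => ?_
    rw [← sum_add_distrib, ← sum_add_distrib]
    refine sum_congr rfl fun y _ => ?_
    rcases lt_trichotomy (κ b) (κ y) with h | h | h
    · have h' : b ≠ y := fun hh => by subst hh; exact lt_irrefl _ h
      simp [h, h.not_gt, h']
    · have h' : b = y := hκ h
      simp [h']
    · have h' : b ≠ y := fun hh => by subst hh; exact lt_irrefl _ h
      simp [h, h.not_gt, h']
  have h2 : ∑ b ∈ P, ∑ y ∈ P, (if κ y < κ b then g b * g y else 0)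
      = ∑ b ∈ P, ∑ y ∈ P, (if κ b < κ y then g b * g y else 0) := by
    rw [sum_comm]
    refine sum_congr rfl fun b _ => sum_congr rfl fun y _ => ?_
    rw [mul_comm]
  have h3 : ∑ b ∈ P, ∑ y ∈ P, (if b = y then g b * g y else 0) = ∑ b ∈ P, g b ^ 2 := by
    refine sum_congr rfl fun b hb => ?_
    rw [sum_ite_eq]; simp [hb, sq]
  have h4 : ∑ b ∈ P, g b * ∑ y ∈ P with κ b < κ y, g y
      = ∑ b ∈ P, ∑ y ∈ P, (if κ b < κ y then g b * g y else 0) := by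
    refine sum_congr rfl fun b _ => ?_
    rw [sum_filter, mul_sum]
    refine sum_congr rfl fun y _ => ?_
    split_ifs <;> simp
  have h5 := newton2 P g
  rw [h4]
  have : (2 : ℤ[X]) ≠ 0 := two_ne_zero
  apply mul_left_cancel₀ this
  linear_combination h5 - h1 - h2 + h3 * (-1) + 2 * h2 - 2 * h2

lemma local_total (S : Sys) {s : Finset (ℕ × ℕ)} (hs : Low s) :
    ∑ b ∈ remS s, ∑ x ∈ addS s,
      (X : ℤ[X]) ^ (S.f s b + S.e s x + if S.κ (shiftB b) < S.κ x then 1 else 0)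
      = (1 + X) * (S.F s 1 + X * S.F s 2) := by
  set g : ℕ × ℕ → ℤ[X] := fun b => X ^ S.f s b with hg
  have h1 : ∀ b ∈ remS s, ∑ x ∈ addS s,
      (X : ℤ[X]) ^ (S.f s b + S.e s x + if S.κ (shiftB b) < S.κ x then 1 else 0)
      = (1 + X) * g b + X * (g b * ∑ y ∈ remS s, g y) - X * g b ^ 2
        + (X ^ 2 - X) * (g b * ∑ y ∈ remS s with S.κ (shiftB b) < S.κ (shiftB y), g y) := by
    intro b hb
    have e1 := sum_addS S hs
    have e2 := sum_upper S hs hb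
    have e3 := mul_geom_sum (X : ℤ[X]) (S.f s b + 1)
    have e4 : ∑ x ∈ addS s,
      (X : ℤ[X]) ^ (S.f s b + S.e s x + if S.κ (shiftB b) < S.κ x then 1 else 0)
      = g b * (∑ x ∈ addS s, X ^ S.e s x
        + (X - 1) * ∑ x ∈ addS s with S.κ (shiftB b) < S.κ x, X ^ S.e s x) := by
      rw [sum_filter, mul_sum, ← sum_add_distrib, mul_sum]
      refine sum_congr rfl fun x _ => ?_
      split_ifs <;> simp only [hg, pow_add] <;> ring
    have e5 : (X : ℤ[X]) ^ (S.f s b + 1) = X * g b := by rw [pow_succ']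
    rw [e5] at e3
    rw [e4, e1]
    linear_combination g b * (X - 1) * e2 - g b * e3
  rw [sum_congr rfl h1]
  have p := pairs_eq (fun b => S.κ (shiftB b)) (S.inj.comp shiftB_inj) (remS s) g
  have q := newton2 (remS s) g
  have f1 : S.F s 1 = ∑ b ∈ remS s, g b := by
    rw [Sys.F, powersetCard_one, sum_map]
    simp [hg]
  have f2 : S.F s 2 = ∑ B ∈ powersetCard 2 (remS s), ∏ b ∈ B, g b := rfl
  rw [sum_add_distrib, sum_sub_distrib, sum_add_distrib, ← mul_sum, ← mul_sum, ← mul_sum,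
    ← mul_sum, ← sum_mul, p, f1, f2]
  linear_combination X * q

lemma F_zero_of_lt (S : Sys) {s : Finset (ℕ × ℕ)} {k : ℕ} (h : s.card < k) : S.F s k = 0 := by
  rw [Sys.F, powersetCard_eq_empty.2, sum_empty]
  exact (card_le_card (filter_subset _ _)).trans_lt h

lemma G_succ (S : Sys) {s : Finset (ℕ × ℕ)} (hs : Low s) (k : ℕ) :
    S.G s (k + 1) = X ^ (k + 1) * S.F s (k + 1) + X ^ k * S.F s k := by
  have hF : ∀ j, X ^ j * S.F s j
      = ((remS s).val.map fun b => (X : ℤ[X]) ^ (S.f s b + 1)).esymm j := by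
    intro j
    rw [Finset.esymm_map_val, Sys.F, mul_sum]
    refine sum_congr rfl fun B hB => ?_
    simp only [pow_succ', prod_mul_distrib, prod_const, (mem_powersetCard.1 hB).2]
  have hG : S.G s (k + 1) = ((addS s).val.map fun b => (X : ℤ[X]) ^ (S.e s b)).esymm (k + 1) := by
    rw [Finset.esymm_map_val, Sys.G]
  have h2 : (addS s).val.map (fun b => (X : ℤ[X]) ^ (S.e s b))
      = 1 ::ₘ (remS s).val.map fun b => (X : ℤ[X]) ^ (S.f s b + 1) := by
    have := congrArg (fun m => (m.map (fun i => (X : ℤ[X]) ^ i))) (S.H2 hs)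
    simpa only [Multiset.map_map, Multiset.map_cons, pow_zero, Function.comp_def] using this
  rw [hG, hF, hF, h2]
  simp [Multiset.esymm, Multiset.powersetCard_cons]

/-- Low sets of given size. -/
noncomputable def Ys (N : ℕ) : Finset (Finset (ℕ × ℕ)) := by
  classical
  exact ((range N ×ˢ range N).powerset).filter fun s => Low s ∧ s.card = N

lemma mem_Ys {N : ℕ} {s : Finset (ℕ × ℕ)} : s ∈ Ys N ↔ Low s ∧ s.card = N := by
  simp only [Ys, mem_filter, mem_powerset, and_iff_right_iff_imp]
  rintro ⟨h, rfl⟩ ⟨u, v⟩ hx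
  simpa using h.lt_card hx

lemma low_sdiff {s B : Finset (ℕ × ℕ)} (hs : Low s) (hB : B ⊆ remS s) :
    Low (s \ B) ∧ B ⊆ addS (s \ B) := by
  have h1 : Low (s \ B) := by
    intro u v u' v' h hu hv
    rw [mem_sdiff] at h ⊢
    refine ⟨hs u v u' v' h.1 hu hv, fun hb => ?_⟩
    have hb' := mem_remS.1 (hB hb)
    rcases Nat.lt_or_ge u' u with h' | h'
    · exact hb'.2.1 (hs u v _ _ h.1 h' hv)
    rcases Nat.lt_or_ge v' v with h'' | h''
    · exact hb'.2.2 (hs u v _ _ h.1 hu h'')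
    have e1 : u' = u := by omega
    have e2 : v' = v := by omega
    subst e1 e2
    exact h.2 hb
  refine ⟨h1, ?_⟩
  rintro ⟨u, v⟩ hb
  rw [mem_addS h1]
  have hb' := mem_remS.1 (hB hb)
  simp only [mem_sdiff] at hb' ⊢
  refine ⟨fun h => h.2 hb, ?_, ?_⟩
  · rcases Nat.eq_zero_or_pos u with h | h
    · exact Or.inl h
    · refine Or.inr ⟨hs u v _ _ hb'.1 (by omega) le_rfl, fun h' => ?_⟩
      have := (mem_remS.1 (hB h')).2.1
      simp only [Nat.sub_add_cancel h] at this
      exact this hb'.1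
  · rcases Nat.eq_zero_or_pos v with h | h
    · exact Or.inl h
    · refine Or.inr ⟨hs u v _ _ hb'.1 le_rfl (by omega), fun h' => ?_⟩
      have := (mem_remS.1 (hB h')).2.2
      simp only [Nat.sub_add_cancel h] at this
      exact this hb'.1

lemma low_union {s B : Finset (ℕ × ℕ)} (hs : Low s) (hB : B ⊆ addS s) :
    Low (s ∪ B) ∧ B ⊆ remS (s ∪ B) ∧ Disjoint s B := by
  have h1 : Low (s ∪ B) := by
    intro u v u' v' h hu hv
    rw [mem_union] at h ⊢
    rcases h with h | h
    · exact Or.inl (hs u v u' v' h hu hv)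
    have hb' := (mem_addS hs).1 (hB h)
    simp only at hb'
    rcases Nat.lt_or_ge u' u with h' | h'
    · rcases hb'.2.1 with h2 | h2
      · omega
      · exact Or.inl (hs _ _ _ _ h2 (by omega) hv)
    rcases Nat.lt_or_ge v' v with h'' | h''
    · rcases hb'.2.2 with h2 | h2
      · omega
      · exact Or.inl (hs _ _ _ _ h2 hu (by omega))
    have e1 : u' = u := by omega
    have e2 : v' = v := by omega
    subst e1 e2
    exact Or.inr h
  refine ⟨h1, ?_, ?_⟩
  · rintro ⟨u, v⟩ hb
    have hb' := (mem_addS hs).1 (hB hb)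
    rw [mem_remS]
    simp only [mem_union, not_or]
    refine ⟨Or.inr hb, ⟨fun h => hb'.1 (hs _ _ _ _ h (by omega) le_rfl), fun h => ?_⟩,
      ⟨fun h => hb'.1 (hs _ _ _ _ h le_rfl (by omega)), fun h => ?_⟩⟩
    · have := ((mem_addS hs).1 (hB h)).2.1
      simp at this
      exact hb'.1 this
    · have := ((mem_addS hs).1 (hB h)).2.2
      simp at this
      exact hb'.1 this
  · rw [disjoint_left]
    intro x hx hb
    exact ((mem_addS hs).1 (hB hb)).1 hx

/-- The global generating functions. -/
noncomputable def Sys.A (S : Sys) (k N : ℕ) : ℤ[X] := ∑ s ∈ Ys N, X ^ S.w s * S.F s k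

lemma A_shift (S : Sys) (k N : ℕ) :
    S.A k (N + k) = ∑ s ∈ Ys N, X ^ S.w s * S.G s k := by
  simp only [Sys.A, Sys.F, Sys.G, mul_sum]
  rw [sum_sigma', sum_sigma']
  refine sum_bij' (fun p _ => ⟨p.1 \ p.2, p.2⟩) (fun p _ => ⟨p.1 ∪ p.2, p.2⟩) ?_ ?_ ?_ ?_ ?_
  · rintro ⟨s, B⟩ h
    simp only [mem_sigma, mem_Ys, mem_powersetCard] at h ⊢
    obtain ⟨⟨hs, hc⟩, hB, hk⟩ := h
    have := low_sdiff hs hB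
    refine ⟨⟨this.1, ?_⟩, this.2, hk⟩
    rw [card_sdiff_of_subset (hB.trans (filter_subset _ _))]; omega
  · rintro ⟨s, B⟩ h
    simp only [mem_sigma, mem_Ys, mem_powersetCard] at h ⊢
    obtain ⟨⟨hs, hc⟩, hB, hk⟩ := h
    have := low_union hs hB
    refine ⟨⟨this.1, ?_⟩, this.2.1, hk⟩
    rw [card_union_of_disjoint this.2.2]; omega
  · rintro ⟨s, B⟩ h
    simp only [mem_sigma, mem_Ys, mem_powersetCard] at h
    simp only [Sigma.mk.injEq, heq_eq_eq, and_true]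
    exact sdiff_union_of_subset (h.2.1.trans (filter_subset _ _))
  · rintro ⟨s, B⟩ h
    simp only [mem_sigma, mem_Ys, mem_powersetCard] at h
    simp only [Sigma.mk.injEq, heq_eq_eq, and_true]
    exact union_sdiff_cancel_right (low_union h.1.1 h.2.1).2.2
  · rintro ⟨s, B⟩ h
    simp only [mem_sigma, mem_Ys, mem_powersetCard] at h
    simp only [prod_pow_eq_pow_sum, ← pow_add]
    rw [S.H3 s h.1.1 B h.2.1]

lemma A_rec (S : Sys) (k N : ℕ) :
    S.A (k + 1) (N + (k + 1)) = X ^ (k + 1) * S.A (k + 1) N + X ^ k * S.A k N := by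
  rw [A_shift]
  simp only [Sys.A, mul_sum]
  rw [← sum_add_distrib]
  refine sum_congr rfl fun s hs => ?_
  rw [G_succ S (mem_Ys.1 hs).1]
  ring

lemma A_zero_of_lt (S : Sys) {k N : ℕ} (h : N < k) : S.A k N = 0 := by
  rw [Sys.A]
  refine sum_eq_zero fun s hs => ?_
  rw [F_zero_of_lt S (by rw [(mem_Ys.1 hs).2]; exact h), mul_zero]

lemma A_zero_zero (S : Sys) : S.A 0 0 = 1 := by
  have : Ys 0 = {∅} := by
    ext s
    rw [mem_Ys, mem_singleton, card_eq_zero]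
    constructor
    · exact fun h => h.2
    · rintro rfl; exact ⟨fun _ _ _ _ h => absurd h (by simp), rfl⟩
  simp [Sys.A, this, Sys.F, S.H0]

lemma A_alt (S : Sys) {N : ℕ} (hN : 0 < N) :
    ∑ k ∈ range (N + 1), (-1) ^ k * S.A k N = 0 := by
  simp only [Sys.A, mul_sum]
  rw [sum_comm]
  refine sum_eq_zero fun s hs => ?_
  obtain ⟨hs, hc⟩ := mem_Ys.1 hs
  have h1 : ∑ k ∈ range (N + 1), (-1) ^ k * (X ^ S.w s * S.F s k)
      = X ^ S.w s * ∑ k ∈ range (#(remS s) + 1), (-1) ^ k * S.F s k := by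
    rw [mul_sum]
    symm
    have hle : #(remS s) ≤ N := hc ▸ card_le_card (filter_subset _ _)
    have : range (#(remS s) + 1) ⊆ range (N + 1) := range_subset_range.2 (by omega)
    rw [← sum_subset this]
    · exact sum_congr rfl fun k _ => by ring
    · intro k _ hk
      rw [mem_range] at hk
      rw [Sys.F, powersetCard_eq_empty.2 (by omega)]; simp
  have h2 : ∏ b ∈ remS s, (1 + -(X : ℤ[X]) ^ S.f s b)
      = ∑ k ∈ range (#(remS s) + 1), (-1) ^ k * S.F s k := by
    rw [prod_one_add, sum_powerset]
    refine sum_congr rfl fun k _ => ?_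
    rw [Sys.F, mul_sum]
    refine sum_congr rfl fun B hB => ?_
    rw [prod_neg, (mem_powersetCard.1 hB).2]
  rw [h1, ← h2]
  have hne : (remS s).Nonempty := remS_nonempty (card_pos.1 (by omega))
  obtain ⟨b, hb, hmax⟩ := exists_max_image (remS s) (fun b => S.κ (shiftB b)) hne
  have h3 := S.HP s hs b hb
  have h4 : ({y ∈ remS s | S.κ (shiftB b) < S.κ (shiftB y)} : Finset _) = ∅ := by
    rw [filter_eq_empty_iff]
    intro y hy
    exact not_lt.2 (hmax y hy)
  rw [h4, card_empty] at h3
  have h5 : S.f s b = 0 := by omega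
  rw [prod_eq_zero hb (by rw [h5]; simp), mul_zero]

lemma A_unique (S T : Sys) : ∀ N k, S.A k N = T.A k N := by
  intro N
  induction N using Nat.strong_induction_on with
  | _ N ih =>
    have hpos : ∀ k, S.A (k + 1) N = T.A (k + 1) N := by
      intro k
      rcases Nat.lt_or_ge N (k + 1) with h | h
      · rw [A_zero_of_lt S h, A_zero_of_lt T h]
      · obtain ⟨M, rfl⟩ := Nat.exists_eq_add_of_le' h
        rw [A_rec, A_rec, ih M (by omega), ih M (by omega)]
    intro k
    rcases k with _ | k
    · rcases Nat.eq_zero_or_pos N with rfl | h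
      · rw [A_zero_zero, A_zero_zero]
      · have h1 := A_alt S h
        have h2 := A_alt T h
        rw [sum_range_succ'] at h1 h2
        simp only [hpos] at h1
        simp only [pow_zero, one_mul] at h1 h2
        linear_combination h1 - h2
    · exact hpos k

lemma total_unique (S T : Sys) (N : ℕ) :
    ∑ s ∈ Ys N, ∑ b ∈ remS s, ∑ x ∈ addS s,
      (X : ℤ[X]) ^ (S.w s + S.f s b + S.e s x + if S.κ (shiftB b) < S.κ x then 1 else 0)
    = ∑ s ∈ Ys N, ∑ b ∈ remS s, ∑ x ∈ addS s,
      (X : ℤ[X]) ^ (T.w s + T.f s b + T.e s x + if T.κ (shiftB b) < T.κ x then 1 else 0) := by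
  have key : ∀ S : Sys, ∑ s ∈ Ys N, ∑ b ∈ remS s, ∑ x ∈ addS s,
      (X : ℤ[X]) ^ (S.w s + S.f s b + S.e s x + if S.κ (shiftB b) < S.κ x then 1 else 0)
      = (1 + X) * (S.A 1 N + X * S.A 2 N) := by
    intro S
    simp only [Sys.A]
    rw [mul_add, mul_sum, mul_sum, mul_sum, ← sum_add_distrib]
    refine sum_congr rfl fun s hs => ?_
    have h := local_total S (mem_Ys.1 hs).1
    have e : ∀ b x, (X : ℤ[X]) ^ (S.w s + S.f s b + S.e s x
        + if S.κ (shiftB b) < S.κ x then 1 else 0)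
        = X ^ S.w s * X ^ (S.f s b + S.e s x + if S.κ (shiftB b) < S.κ x then 1 else 0) := by
      intro b x
      rw [← pow_add]; congr 1; omega
    simp only [e, ← mul_sum]
    rw [h]; ring
  rw [key, key, A_unique S T, A_unique S T]


lemma count_of_tele {s : Finset (ℕ × ℕ)} (φ : ℕ × ℕ → Prop) [DecidablePred φ] (E : ℕ)
    (h : ∑ b ∈ remS s, (if φ (shiftB b) then (1 : ℤ) else 0)
      - ∑ x ∈ addS s, (if φ x then (1 : ℤ) else 0) = E) :
    E + #{y ∈ addS s | φ y} = #{y ∈ remS s | φ (shiftB y)} := by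
  rw [card_filter, card_filter]
  zify
  push_cast
  linarith

/-- The key for the statistic at infinity. -/
def kInf (x : ℕ × ℕ) : ℕ ×ₗ ℕ := toLex (x.2, x.1)

lemma kInf_lt (x y : ℕ × ℕ) : kInf x < kInf y ↔ x.2 < y.2 ∨ x.2 = y.2 ∧ x.1 < y.1 := by
  simp [kInf, Prod.Lex.toLex_lt_toLex]

lemma tele_inf {s : Finset (ℕ × ℕ)} (hs : Low s) (x : ℕ × ℕ) (hx : x ∉ s) :
    (if 0 < x.2 ∧ (x.1, x.2 - 1) ∈ s then 1 else 0) + #{y ∈ addS s | kInf x < kInf y}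
      = #{y ∈ remS s | kInf x < kInf (shiftB y)} := by
  obtain ⟨c, r, hc, hr⟩ := hs.exists_lens
  obtain ⟨u, v⟩ := x
  apply count_of_tele
  rw [tele_aux hs hc hr (fun y => if kInf (u, v) < kInf y then (1 : ℤ) else 0) (c 0 + v + 1)
    (by omega)]
  simp only [kInf_lt]
  rw [hr] at hx
  have h1 : ∀ w ∈ range (c 0 + v + 1),
      ((if v < w + 1 ∨ v = w + 1 ∧ u < r w then (1 : ℤ) else 0)
        - (if v < w ∨ v = w ∧ u < r w then (1 : ℤ) else 0))
      = (if w = v then 1 else 0) + (if w = v - 1 then (if 0 < v ∧ u < r (v - 1) then 1 else 0)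
          else 0) := by
    intro w _
    rcases Nat.lt_trichotomy w v with h | h | h
    · rcases Nat.lt_or_ge (w + 1) v with h' | h'
      · rw [if_neg (by omega), if_neg (by omega), if_neg (by omega), if_neg (by omega)]
        simp
      · have e : v = w + 1 := by omega
        subst e
        simp
    · subst h
      rw [if_pos (by omega), if_neg (by omega), if_pos rfl]
      by_cases h0 : w = 0
      · subst h0; simp
      · rw [if_neg (by omega)]; simp
    · rw [if_pos (by omega), if_pos (by omega), if_neg (by omega), if_neg (by omega)]
      simp
  have h2 : (if v < c 0 + v + 1 ∨ v = c 0 + v + 1 ∧ u < 0 then (1 : ℤ) else 0) = 1 :=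
    if_pos (Or.inl (by omega))
  rw [sum_congr rfl h1, sum_add_distrib, sum_ite_eq', sum_ite_eq', if_pos (by simp),
    if_pos (by simp; omega), h2]
  simp only [hr]
  push_cast
  ring

/-- The system at infinity. -/
def sysInf : Sys where
  κ := kInf
  w s := #{c ∈ s | c.2 ≠ 0}
  e _ b := if b.2 = 0 then 0 else 1
  f _ _ := 0
  inj := by
    rintro ⟨a, b⟩ ⟨c, d⟩ h
    have h' : ((b, a) : ℕ × ℕ) = (d, c) := h
    simp only [Prod.mk.injEq] at h' ⊢
    exact ⟨h'.2, h'.1⟩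
  H0 := rfl
  H3 s hs B hB := by
    have hB' : B ⊆ s := hB.trans (filter_subset _ _)
    simp only [sum_const_zero, add_zero, card_filter]
    rw [← sum_sdiff hB']
    simp only [ne_eq, ite_not]
  HV s hs x hx := by
    rw [mem_addS hs] at hx
    rw [← tele_inf hs x hx.1]
    congr 1
    rcases hx.2.2 with h | h
    · simp [h]
    · by_cases h0 : x.2 = 0
      · simp [h0]
      · rw [if_neg h0, if_pos ⟨by omega, h⟩]
  HP s hs x hx := by
    rw [mem_remS] at hx
    have hn : shiftB x ∉ s := fun h => hx.2.1 (hs _ _ _ _ h le_rfl (Nat.le_succ _))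
    rw [← tele_inf hs _ hn]
    congr 1
    rw [if_neg]
    rintro ⟨_, h⟩
    exact hx.2.1 h

/-- The key for the other statistic. -/
def kOne (x : ℕ × ℕ) : ℕ ×ₗ ℕ := toLex (x.1 + x.2, x.2)

lemma kOne_lt (x y : ℕ × ℕ) : kOne x < kOne y ↔
    x.1 + x.2 < y.1 + y.2 ∨ x.1 + x.2 = y.1 + y.2 ∧ x.2 < y.2 := by
  simp [kOne, Prod.Lex.toLex_lt_toLex]

lemma tele_one {s : Finset (ℕ × ℕ)} (hs : Low s) {c r : ℕ → ℕ}
    (hc : ∀ u v, (u, v) ∈ s ↔ v < c u) (hr : ∀ u v, (u, v) ∈ s ↔ u < r v)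
    (u v : ℕ) (hx : (u, v) ∉ s) :
    (#{w ∈ range v | r w + w = u + v} + #{t ∈ range u | t + c t + 1 = u + v ∧ v < c t})
      + #{y ∈ addS s | kOne (u, v) < kOne y}
      = #{y ∈ remS s | kOne (u, v) < kOne (shiftB y)} := by
  apply count_of_tele
  have hsplit : ∀ y : ℕ × ℕ, (if kOne (u, v) < kOne y then (1 : ℤ) else 0)
      = (if u < y.1 ∧ u + v < y.1 + y.2 then 1 else 0)
        + (if v < y.2 ∧ u + v ≤ y.1 + y.2 ∧ y.1 ≤ u then 1 else 0) := by
    intro y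
    simp only [kOne_lt]
    split_ifs <;> first | rfl | (exfalso; omega)
  simp only [hsplit, sum_add_distrib]
  have t1 := tele_aux hs hc hr (fun y => if u < y.1 ∧ u + v < y.1 + y.2 then (1 : ℤ) else 0)
    (c 0 + v) (by omega)
  have t2 := tele_aux' hs hc hr
    (fun y => if v < y.2 ∧ u + v ≤ y.1 + y.2 ∧ y.1 ≤ u then (1 : ℤ) else 0)
    (r 0 + u) (by omega)
  have c1 : ∑ w ∈ range (c 0 + v), ((if u < r w ∧ u + v < r w + (w + 1) then (1 : ℤ) else 0)
        - if u < r w ∧ u + v < r w + w then 1 else 0)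
      = (#{w ∈ range v | r w + w = u + v} : ℤ) := by
    rw [card_filter]
    push_cast
    have hsub : range v ⊆ range (c 0 + v) := range_subset_range.2 (by omega)
    rw [← sum_subset hsub]
    · refine sum_congr rfl fun w hw => ?_
      rw [mem_range] at hw
      split_ifs <;> first | rfl | (exfalso; omega)
    · intro w _ hw
      rw [mem_range] at hw
      split_ifs <;> first | rfl | (exfalso; omega)
  have hx' := hx
  rw [hc] at hx'
  have c2 : ∑ t ∈ range (r 0 + u),
        ((if v < c t ∧ u + v ≤ t + 1 + c t ∧ t + 1 ≤ u then (1 : ℤ) else 0)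
        - if v < c t ∧ u + v ≤ t + c t ∧ t ≤ u then 1 else 0)
      = (#{t ∈ range u | t + c t + 1 = u + v ∧ v < c t} : ℤ) := by
    rw [card_filter]
    push_cast
    have hsub : range u ⊆ range (r 0 + u) := range_subset_range.2 (by omega)
    rw [← sum_subset hsub]
    · refine sum_congr rfl fun t ht => ?_
      rw [mem_range] at ht
      split_ifs <;> first | rfl | (exfalso; omega)
    · intro t _ ht
      rw [mem_range] at ht
      by_cases h : t = u
      · subst h
        split_ifs <;> first | rfl | (exfalso; omega)
      · split_ifs <;> first | rfl | (exfalso; omega)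
  simp only [c1] at t1
  simp only [c2] at t2
  rw [if_neg (by omega)] at t1
  rw [if_neg (by omega)] at t2
  push_cast
  linarith

lemma hookDiff_eq {s : Finset (ℕ × ℕ)} {c r : ℕ → ℕ}
    (hc : ∀ u v, (u, v) ∈ s ↔ v < c u) (hr : ∀ u v, (u, v) ∈ s ↔ u < r v)
    {u v : ℕ} (h : (u, v) ∈ s) : hookDiff s (u, v) = (r v : ℤ) + v - c u - u := by
  have h1 : ({d ∈ s | d.2 = v ∧ u < d.1} : Finset _)
      = (Ico (u + 1) (r v)).image fun i => (i, v) := by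
    ext ⟨a, b⟩
    simp only [mem_filter, mem_image, mem_Ico, Prod.mk.injEq, hr]
    constructor
    · rintro ⟨h5, rfl, h6⟩; exact ⟨a, ⟨h6, h5⟩, rfl, rfl⟩
    · rintro ⟨i, ⟨h1, h2⟩, rfl, rfl⟩; exact ⟨h2, rfl, h1⟩
  have h2 : ({d ∈ s | d.1 = u ∧ v < d.2} : Finset _)
      = (Ico (v + 1) (c u)).image fun i => (u, i) := by
    ext ⟨a, b⟩
    simp only [mem_filter, mem_image, mem_Ico, Prod.mk.injEq, hc]
    constructor
    · rintro ⟨h5, rfl, h6⟩; exact ⟨b, ⟨h6, h5⟩, rfl, rfl⟩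
    · rintro ⟨i, ⟨h1, h2⟩, rfl, rfl⟩; exact ⟨h2, rfl, h1⟩
  simp only [hookDiff]
  rw [h1, h2, card_image_of_injective _ (fun a b h => by simpa using h),
    card_image_of_injective _ (fun a b h => by simpa using h), Nat.card_Ico, Nat.card_Ico]
  have a1 := (hr u v).1 h
  have a2 := (hc u v).1 h
  omega

/-- Weight of a diagram. -/
def wOne (s : Finset (ℕ × ℕ)) : ℕ := (s.filter fun c => hookDiff s c ≠ 0 ∧ hookDiff s c ≠ 1).card

/-- Weight of an addable box. -/
def eOne (s : Finset (ℕ × ℕ)) (b : ℕ × ℕ) : ℕ :=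
  (s.filter fun c => (hookDiff s c = 0 ∧ c.1 = b.1) ∨ (hookDiff s c = 1 ∧ c.2 = b.2)).card

/-- Weight of a removable box. -/
def fOne (s : Finset (ℕ × ℕ)) (b : ℕ × ℕ) : ℕ :=
  (s.filter fun c =>
    (hookDiff s c = 0 ∧ c.2 = b.2 ∧ c ≠ b) ∨ (hookDiff s c = 1 ∧ c.1 = b.1)).card

lemma eOne_eq {s : Finset (ℕ × ℕ)} (hs : Low s) {c r : ℕ → ℕ}
    (hc : ∀ u v, (u, v) ∈ s ↔ v < c u) (hr : ∀ u v, (u, v) ∈ s ↔ u < r v)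
    (u v : ℕ) (hx : (u, v) ∈ addS s) :
    eOne s (u, v)
      = #{w ∈ range v | r w + w = u + v} + #{t ∈ range u | t + c t + 1 = u + v ∧ v < c t} := by
  rw [mem_addS hs] at hx
  have hru : r v = u := by
    simp only [hr] at hx; omega
  have hcv : c u = v := by
    simp only [hc] at hx; omega
  rw [eOne, filter_or, card_union_of_disjoint]
  · congr 1
    · refine card_nbij' (fun x => x.2) (fun w => (u, w)) ?_ ?_ ?_ ?_
      · rintro ⟨a, b⟩ h
        simp only [coe_filter, Set.mem_ofPred_eq, mem_range] at h ⊢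
        obtain ⟨h1, h2, rfl⟩ := h
        rw [hookDiff_eq hc hr h1] at h2
        rw [hc] at h1
        omega
      · intro w h
        simp only [coe_filter, Set.mem_ofPred_eq, mem_range] at h ⊢
        have h1 : (u, w) ∈ s := (hc _ _).2 (by omega)
        rw [hookDiff_eq hc hr h1]
        exact ⟨h1, by omega, trivial⟩
      · rintro ⟨a, b⟩ h
        simp only [coe_filter, Set.mem_ofPred_eq] at h
        rw [h.2.2]
      · intro w h; rfl
    · refine card_nbij' (fun x => x.1) (fun w => (w, v)) ?_ ?_ ?_ ?_
      · rintro ⟨a, b⟩ h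
        simp only [coe_filter, Set.mem_ofPred_eq, mem_range] at h ⊢
        obtain ⟨h1, h2, rfl⟩ := h
        rw [hookDiff_eq hc hr h1] at h2
        have h3 := (hc _ _).1 h1
        rw [hr] at h1
        omega
      · intro w h
        simp only [coe_filter, Set.mem_ofPred_eq, mem_range] at h ⊢
        have h1 : (w, v) ∈ s := (hr _ _).2 (by omega)
        rw [hookDiff_eq hc hr h1]
        exact ⟨h1, by omega, trivial⟩
      · rintro ⟨a, b⟩ h
        simp only [coe_filter, Set.mem_ofPred_eq] at h
        rw [h.2.2]
      · intro w h; rfl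
  · rw [disjoint_left]
    intro x h1 h2
    have h1 := (mem_filter.1 h1).2.1
    have h2 := (mem_filter.1 h2).2.1
    omega

lemma fOne_eq {s : Finset (ℕ × ℕ)} {c r : ℕ → ℕ}
    (hc : ∀ u v, (u, v) ∈ s ↔ v < c u) (hr : ∀ u v, (u, v) ∈ s ↔ u < r v)
    (u v : ℕ) (hx : (u, v) ∈ remS s) :
    fOne s (u, v)
      = #{w ∈ range (v + 1) | r w + w = (u + 1) + (v + 1)}
        + #{t ∈ range (u + 1) | t + c t + 1 = (u + 1) + (v + 1) ∧ v + 1 < c t} := by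
  rw [mem_remS] at hx
  have hru : r v = u + 1 := by
    simp only [hr] at hx; omega
  have hcv : c u = v + 1 := by
    simp only [hc] at hx; omega
  rw [fOne, filter_or, card_union_of_disjoint, add_comm]
  · congr 1
    · refine card_nbij' (fun x => x.2) (fun w => (u, w)) ?_ ?_ ?_ ?_
      · rintro ⟨a, b⟩ h
        simp only [coe_filter, Set.mem_ofPred_eq, mem_range] at h ⊢
        obtain ⟨h1, h2, rfl⟩ := h
        rw [hookDiff_eq hc hr h1] at h2
        rw [hc] at h1
        omega
      · intro w h
        simp only [coe_filter, Set.mem_ofPred_eq, mem_range] at h ⊢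
        have h1 : (u, w) ∈ s := (hc _ _).2 (by omega)
        rw [hookDiff_eq hc hr h1]
        exact ⟨h1, by omega, trivial⟩
      · rintro ⟨a, b⟩ h
        simp only [coe_filter, Set.mem_ofPred_eq] at h
        rw [h.2.2]
      · intro w h; rfl
    · refine card_nbij' (fun x => x.1) (fun w => (w, v)) ?_ ?_ ?_ ?_
      · rintro ⟨a, b⟩ h
        simp only [coe_filter, Set.mem_ofPred_eq, mem_range, ne_eq, Prod.mk.injEq] at h ⊢
        obtain ⟨h1, h2, rfl, h4⟩ := h
        rw [hookDiff_eq hc hr h1] at h2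
        have h3 := (hc _ _).1 h1
        rw [hr] at h1
        have h5 : a ≠ u := fun h => h4 ⟨h, rfl⟩
        omega
      · intro w h
        simp only [coe_filter, Set.mem_ofPred_eq, mem_range, ne_eq, Prod.mk.injEq] at h ⊢
        have h1 : (w, v) ∈ s := (hr _ _).2 (by omega)
        rw [hookDiff_eq hc hr h1]
        refine ⟨h1, by omega, trivial, ?_⟩
        rintro ⟨rfl, _⟩
        omega
      · rintro ⟨a, b⟩ h
        simp only [coe_filter, Set.mem_ofPred_eq] at h
        rw [h.2.2.1]
      · intro w h; rfl
  · rw [disjoint_left]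
    intro x h1 h2
    have h1 := (mem_filter.1 h1).2.1
    have h2 := (mem_filter.1 h2).2.1
    omega

lemma one_H3 {s : Finset (ℕ × ℕ)} (hs : Low s) {B : Finset (ℕ × ℕ)} (hB : B ⊆ remS s) :
    wOne s + ∑ b ∈ B, fOne s b = wOne (s \ B) + ∑ b ∈ B, eOne (s \ B) b := by
  have hBs : B ⊆ s := hB.trans (filter_subset _ _)
  -- two boxes of `B` in the same row or column agree
  have row : ∀ b ∈ B, ∀ c ∈ s, c.2 = b.2 → c ≠ b → c.1 < b.1 := by
    rintro ⟨b1, b2⟩ hb ⟨c1, c2⟩ hc h hne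
    simp only at h ⊢
    subst h
    by_contra hlt
    have hne' : c1 ≠ b1 := fun h => hne (by rw [h])
    exact (mem_remS.1 (hB hb)).2.1 (hs _ _ _ _ hc (by simp only; omega) le_rfl)
  have col : ∀ b ∈ B, ∀ c ∈ s, c.1 = b.1 → c ≠ b → c.2 < b.2 := by
    rintro ⟨b1, b2⟩ hb ⟨c1, c2⟩ hc h hne
    simp only at h ⊢
    subst h
    by_contra hlt
    have hne' : c2 ≠ b2 := fun h => hne (by rw [h])
    exact (mem_remS.1 (hB hb)).2.2 (hs _ _ _ _ hc le_rfl (by simp only; omega))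
  have row' : ∀ b ∈ B, ∀ c ∈ B, c.2 = b.2 → c = b := by
    intro b hb c hc h
    by_contra hne
    have h1 := row b hb c (hBs hc) h hne
    have h2 := row c hc b (hBs hb) h.symm (Ne.symm hne)
    omega
  have col' : ∀ b ∈ B, ∀ c ∈ B, c.1 = b.1 → c = b := by
    intro b hb c hc h
    by_contra hne
    have h1 := col b hb c (hBs hc) h hne
    have h2 := col c hc b (hBs hb) h.symm (Ne.symm hne)
    omega
  have hL : wOne s + ∑ b ∈ B, fOne s b = ∑ c ∈ s,
      ((if hookDiff s c ≠ 0 ∧ hookDiff s c ≠ 1 then 1 else 0)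
        + #{b ∈ B | (hookDiff s c = 0 ∧ c.2 = b.2 ∧ c ≠ b) ∨ (hookDiff s c = 1 ∧ c.1 = b.1)}) := by
    simp only [wOne, fOne, card_filter, sum_add_distrib]
    rw [sum_comm]
  have hR : wOne (s \ B) + ∑ b ∈ B, eOne (s \ B) b = ∑ c ∈ s \ B,
      ((if hookDiff (s \ B) c ≠ 0 ∧ hookDiff (s \ B) c ≠ 1 then 1 else 0)
        + #{b ∈ B | (hookDiff (s \ B) c = 0 ∧ c.1 = b.1) ∨
            (hookDiff (s \ B) c = 1 ∧ c.2 = b.2)}) := by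
    simp only [wOne, eOne, card_filter, sum_add_distrib]
    rw [sum_comm]
  rw [hL, hR, ← sum_sdiff hBs]
  have hz : ∑ c ∈ B, ((if hookDiff s c ≠ 0 ∧ hookDiff s c ≠ 1 then 1 else 0)
        + #{b ∈ B | (hookDiff s c = 0 ∧ c.2 = b.2 ∧ c ≠ b) ∨ (hookDiff s c = 1 ∧ c.1 = b.1)})
      = 0 := by
    refine sum_eq_zero fun c hc => ?_
    have h0 : hookDiff s c = 0 := by
      obtain ⟨cc, r, hcc, hr⟩ := hs.exists_lens
      have hm := mem_remS.1 (hB hc)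
      obtain ⟨u, v⟩ := c
      rw [hookDiff_eq hcc hr hm.1]
      have hru : r v = u + 1 := by
        simp only [hr] at hm; omega
      have hcv : cc u = v + 1 := by
        simp only [hcc] at hm; omega
      rw [hru, hcv]; push_cast; ring
    rw [h0, if_neg (by simp), zero_add, card_eq_zero, filter_eq_empty_iff]
    intro b hb h
    rcases h with h | h
    · exact h.2.2 (row' b hb c hc h.2.1)
    · simp at h
  rw [hz, add_zero]
  refine sum_congr rfl fun c hc => ?_
  obtain ⟨hcs, hcB⟩ := mem_sdiff.1 hc
  set R := #{b ∈ B | b.2 = c.2} with hRdef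
  set K := #{b ∈ B | b.1 = c.1} with hKdef
  have hR1 : R ≤ 1 := by
    rw [hRdef, card_le_one]
    intro a ha b hb
    exact row' b (mem_filter.1 hb).1 a (mem_filter.1 ha).1
      ((mem_filter.1 ha).2.trans (mem_filter.1 hb).2.symm)
  have hK1 : K ≤ 1 := by
    rw [hKdef, card_le_one]
    intro a ha b hb
    exact col' b (mem_filter.1 hb).1 a (mem_filter.1 ha).1
      ((mem_filter.1 ha).2.trans (mem_filter.1 hb).2.symm)
  have hh : hookDiff s c = hookDiff (s \ B) c + R - K := by
    have a1 : #{d ∈ s | d.2 = c.2 ∧ c.1 < d.1} = #{d ∈ s \ B | d.2 = c.2 ∧ c.1 < d.1} + R := by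
      rw [hRdef, card_filter, card_filter, card_filter, ← sum_sdiff hBs]
      congr 1
      refine sum_congr rfl fun b hb => ?_
      have hne : c ≠ b := fun h => hcB (h ▸ hb)
      by_cases h : b.2 = c.2
      · rw [if_pos ⟨h, row b hb c hcs h.symm hne⟩, if_pos h]
      · rw [if_neg (fun h' => h h'.1), if_neg h]
    have a2 : #{d ∈ s | d.1 = c.1 ∧ c.2 < d.2} = #{d ∈ s \ B | d.1 = c.1 ∧ c.2 < d.2} + K := by
      rw [hKdef, card_filter, card_filter, card_filter, ← sum_sdiff hBs]
      congr 1
      refine sum_congr rfl fun b hb => ?_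
      have hne : c ≠ b := fun h => hcB (h ▸ hb)
      by_cases h : b.1 = c.1
      · rw [if_pos ⟨h, col b hb c hcs h.symm hne⟩, if_pos h]
      · rw [if_neg (fun h' => h h'.1), if_neg h]
    simp only [hookDiff]
    rw [a1, a2]
    push_cast
    ring
  have n1 : #{b ∈ B | (hookDiff s c = 0 ∧ c.2 = b.2 ∧ c ≠ b) ∨ (hookDiff s c = 1 ∧ c.1 = b.1)}
      = if hookDiff s c = 0 then R else if hookDiff s c = 1 then K else 0 := by
    split_ifs with h0 h1
    · rw [hRdef]
      congr 1
      refine filter_congr fun b hb => ?_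
      have hne : c ≠ b := fun h => hcB (h ▸ hb)
      simp [h0, hne, eq_comm]
    · rw [hKdef]
      congr 1
      refine filter_congr fun b hb => ?_
      simp [h1, eq_comm]
    · rw [card_eq_zero, filter_eq_empty_iff]
      intro b _
      simp [h0, h1]
  have n2 : #{b ∈ B | (hookDiff (s \ B) c = 0 ∧ c.1 = b.1) ∨
        (hookDiff (s \ B) c = 1 ∧ c.2 = b.2)}
      = if hookDiff (s \ B) c = 0 then K else if hookDiff (s \ B) c = 1 then R else 0 := by
    split_ifs with h0 h1
    · rw [hKdef]
      congr 1
      refine filter_congr fun b hb => ?_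
      simp [h0, eq_comm]
    · rw [hRdef]
      congr 1
      refine filter_congr fun b hb => ?_
      simp [h1, eq_comm]
    · rw [card_eq_zero, filter_eq_empty_iff]
      intro b _
      simp [h0, h1]
  rw [n1, n2]
  split_ifs <;> omega

/-- The other system. -/
def sysOne : Sys where
  κ := kOne
  w := wOne
  e := eOne
  f := fOne
  inj := by
    rintro ⟨a, b⟩ ⟨c, d⟩ h
    have h' : ((a + b, b) : ℕ × ℕ) = (c + d, d) := h
    simp only [Prod.mk.injEq] at h' ⊢
    omega
  H0 := rfl
  H3 s hs B hB := one_H3 hs hB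
  HV s hs x hx := by
    obtain ⟨c, r, hc, hr⟩ := hs.exists_lens
    obtain ⟨u, v⟩ := x
    rw [← tele_one hs hc hr u v ((mem_addS hs).1 hx).1, eOne_eq hs hc hr u v hx]
  HP s hs x hx := by
    obtain ⟨c, r, hc, hr⟩ := hs.exists_lens
    obtain ⟨u, v⟩ := x
    have hn : (u + 1, v + 1) ∉ s := fun h =>
      (mem_remS.1 hx).2.1 (hs _ _ _ _ h le_rfl (Nat.le_succ _))
    have := tele_one hs hc hr (u + 1) (v + 1) hn
    rw [← fOne_eq hc hr u v hx] at this
    exact this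


lemma low_cells (μ : YoungDiagram) : Low μ.cells := by
  intro u v u' v' h hu hv
  exact μ.isLowerSet (a := (u, v)) (b := (u', v')) ⟨hu, hv⟩ h

/-- A Young diagram from a down-closed set. -/
def ofLow (s : Finset (ℕ × ℕ)) (hs : Low s) : YoungDiagram :=
  ⟨s, by
    rintro ⟨a, b⟩ ⟨a', b'⟩ h hm
    exact hs a b a' b' hm h.1 h.2⟩

/-- The index set of flags. -/
noncomputable def Qs (n : ℕ) : Finset (Σ _ : Finset (ℕ × ℕ), (ℕ × ℕ) × (ℕ × ℕ)) :=
  (Ys (n + 1)).sigma fun s => remS s ×ˢ addS s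

lemma flag_rem {n : ℕ} (T : TripleFlag n) : T.b₁ ∈ remS T.Γ₂.cells := by
  have h1 := low_cells T.Γ₁
  have hn : T.b₁ ∉ T.Γ₁.cells := T.not_mem₁
  rw [mem_remS, T.cells₂]
  refine ⟨mem_insert_self _ _, fun h => ?_, fun h => ?_⟩
  · rcases mem_insert.1 h with h | h
    · have := congrArg Prod.fst h; simp at this
    · exact hn (h1 _ _ _ _ h (Nat.le_succ _) le_rfl)
  · rcases mem_insert.1 h with h | h
    · have := congrArg Prod.snd h; simp at this
    · exact hn (h1 _ _ _ _ h le_rfl (Nat.le_succ _))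

lemma flag_add {n : ℕ} (T : TripleFlag n) : T.b₂ ∈ addS T.Γ₂.cells := by
  have h3 := low_cells T.Γ₃
  have hb : T.b₂ ∈ T.Γ₃.cells := by rw [T.cells₃]; exact mem_insert_self _ _
  rw [mem_addS (low_cells _)]
  refine ⟨T.not_mem₂, ?_, ?_⟩
  · rcases Nat.eq_zero_or_pos T.b₂.1 with h | h
    · exact Or.inl h
    · right
      have h4 := h3 T.b₂.1 T.b₂.2 (T.b₂.1 - 1) T.b₂.2 hb (by omega) le_rfl
      rw [T.cells₃] at h4
      rcases mem_insert.1 h4 with h5 | h5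
      · have := congrArg Prod.fst h5
        simp only at this
        omega
      · exact h5
  · rcases Nat.eq_zero_or_pos T.b₂.2 with h | h
    · exact Or.inl h
    · right
      have h4 := h3 T.b₂.1 T.b₂.2 T.b₂.1 (T.b₂.2 - 1) hb le_rfl (by omega)
      rw [T.cells₃] at h4
      rcases mem_insert.1 h4 with h5 | h5
      · have := congrArg Prod.snd h5
        simp only at this
        omega
      · exact h5

lemma flag_card {n : ℕ} (T : TripleFlag n) : T.Γ₂.cells.card = n + 1 := by
  rw [T.cells₂, card_insert_of_notMem T.not_mem₁]
  have := T.card₁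
  simp only [YoungDiagram.card] at this
  omega

lemma flag_sdiff {n : ℕ} (T : TripleFlag n) : T.Γ₁.cells = T.Γ₂.cells \ {T.b₁} := by
  rw [T.cells₂, sdiff_singleton_eq_erase, erase_insert T.not_mem₁]

/-- The value of a system on a flag. -/
def Sys.val (S : Sys) (q : Σ _ : Finset (ℕ × ℕ), (ℕ × ℕ) × (ℕ × ℕ)) : ℕ :=
  S.w q.1 + S.f q.1 q.2.1 + S.e q.1 q.2.2 + if S.κ (shiftB q.2.1) < S.κ q.2.2 then 1 else 0

lemma flag_count (n k : ℕ) (p : TripleFlag n → ℕ) (S : Sys)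
    (h : ∀ T, p T = S.val ⟨T.Γ₂.cells, T.b₁, T.b₂⟩) :
    Nat.card {T : TripleFlag n // p T = k} = #{q ∈ Qs n | S.val q = k} := by
  have hcard : Nat.card {q // q ∈ ({q ∈ Qs n | S.val q = k} : Finset _)}
      = #{q ∈ Qs n | S.val q = k} := by
    rw [Nat.card_eq_fintype_card, Fintype.card_coe]
  rw [← hcard]
  have hmem : ∀ T : TripleFlag n, (⟨T.Γ₂.cells, T.b₁, T.b₂⟩ :
      Σ _ : Finset (ℕ × ℕ), (ℕ × ℕ) × (ℕ × ℕ)) ∈ Qs n := by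
    intro T
    simp only [Qs, mem_sigma, mem_Ys, mem_product]
    exact ⟨⟨low_cells _, flag_card T⟩, flag_rem T, flag_add T⟩
  refine Nat.card_congr (Equiv.ofBijective
    (fun T => ⟨⟨T.1.Γ₂.cells, T.1.b₁, T.1.b₂⟩,
      mem_filter.2 ⟨hmem T.1, by rw [← h]; exact T.2⟩⟩) ⟨?_, ?_⟩)
  · rintro ⟨T, hT⟩ ⟨T', hT'⟩ heq
    simp only [Subtype.mk.injEq, Sigma.mk.injEq, heq_eq_eq, Prod.mk.injEq] at heq
    obtain ⟨e2, eb1, eb2⟩ := heq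
    have e1 : T.Γ₁ = T'.Γ₁ := by
      apply YoungDiagram.ext
      rw [flag_sdiff, flag_sdiff, e2, eb1]
    have e3 : T.Γ₃ = T'.Γ₃ := by
      apply YoungDiagram.ext
      rw [T.cells₃, T'.cells₃, e2, eb2]
    have e2' : T.Γ₂ = T'.Γ₂ := YoungDiagram.ext e2
    apply Subtype.ext
    cases T
    cases T'
    simp only at e1 e2' e3 eb1 eb2
    subst e1 e2' e3 eb1 eb2
    rfl
  · rintro ⟨⟨s, b₁, b₂⟩, hq⟩
    obtain ⟨hq1, hq2⟩ := mem_filter.1 hq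
    simp only [Qs, mem_sigma, mem_Ys, mem_product] at hq1
    obtain ⟨⟨hs, hc⟩, hb1, hb2⟩ := hq1
    have l1 := (low_sdiff hs (singleton_subset_iff.2 hb1)).1
    have l3 := (low_union hs (singleton_subset_iff.2 hb2)).1
    have m1 : b₁ ∈ s := (mem_remS.1 hb1).1
    have m2 : b₂ ∉ s := ((mem_addS hs).1 hb2).1
    let T : TripleFlag n :=
      { Γ₁ := ofLow _ l1
        Γ₂ := ofLow s hs
        Γ₃ := ofLow _ l3
        b₁ := b₁
        b₂ := b₂
        card₁ := by
          change #(s \ {b₁}) = n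
          rw [sdiff_singleton_eq_erase, card_erase_of_mem m1]; omega
        not_mem₁ := by
          change b₁ ∉ s \ {b₁}
          simp
        cells₂ := by
          change s = insert b₁ (s \ {b₁})
          rw [sdiff_singleton_eq_erase, insert_erase m1]
        not_mem₂ := m2
        cells₃ := by
          change s ∪ {b₂} = insert b₂ s
          rw [union_comm]; rfl }
    exact ⟨⟨T, by rw [h]; exact hq2⟩, rfl⟩

lemma count_coeff (n k : ℕ) (S : Sys) :
    (#{q ∈ Qs n | S.val q = k} : ℤ)
      = (∑ s ∈ Ys (n + 1), ∑ b ∈ remS s, ∑ x ∈ addS s,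
      (X : ℤ[X]) ^ (S.w s + S.f s b + S.e s x
        + if S.κ (shiftB b) < S.κ x then 1 else 0)).coeff k := by
  have : ∑ s ∈ Ys (n + 1), ∑ b ∈ remS s, ∑ x ∈ addS s,
      (X : ℤ[X]) ^ (S.w s + S.f s b + S.e s x
        + if S.κ (shiftB b) < S.κ x then 1 else 0) = ∑ q ∈ Qs n, X ^ S.val q := by
    rw [Qs, sum_sigma]
    refine sum_congr rfl fun s _ => ?_
    rw [sum_product]
    rfl
  rw [this, finsetSum_coeff, card_filter]
  push_cast
  refine sum_congr rfl fun q _ => ?_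
  rw [coeff_X_pow]
  simp only [eq_comm]

lemma posOne_eq {n : ℕ} (T : TripleFlag n) :
    posOne T.Γ₁.cells T.Γ₂.cells T.b₁ T.b₂ = sysOne.val ⟨T.Γ₂.cells, T.b₁, T.b₂⟩ := by
  have h3 := one_H3 (low_cells T.Γ₂) (B := {T.b₁}) (singleton_subset_iff.2 (flag_rem T))
  rw [← flag_sdiff, sum_singleton, sum_singleton] at h3
  have hd : (if T.b₁.1 + T.b₁.2 + 2 < T.b₂.1 + T.b₂.2
          ∨ (T.b₂.1 + T.b₂.2 = T.b₁.1 + T.b₁.2 + 2 ∧ T.b₁.2 < T.b₂.2) then 1 else 0)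
      = if kOne (shiftB T.b₁) < kOne T.b₂ then 1 else 0 := by
    have hne := add_ne_rem (low_cells T.Γ₂) (flag_add T) (flag_rem T)
    have hne' : ¬ (T.b₂.1 = T.b₁.1 + 1 ∧ T.b₂.2 = T.b₁.2 + 1) := fun h =>
      hne (Prod.ext h.1 h.2)
    simp only [kOne_lt, shiftB]
    congr 1
    apply propext
    omega
  change wOne T.Γ₁.cells + eOne T.Γ₁.cells T.b₁ + eOne T.Γ₂.cells T.b₂ + _
    = wOne T.Γ₂.cells + fOne T.Γ₂.cells T.b₁ + eOne T.Γ₂.cells T.b₂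
      + if kOne (shiftB T.b₁) < kOne T.b₂ then 1 else 0
  rw [hd, h3]

lemma posInf_eq {n : ℕ} (T : TripleFlag n) :
    posInf T = sysInf.val ⟨T.Γ₂.cells, T.b₁, T.b₂⟩ := by
  have hn : T.b₂ ∉ T.Γ₂.cells := T.not_mem₂
  have h1 : (n + 2) - ell T.Γ₃
      = #{c ∈ T.Γ₂.cells | c.2 ≠ 0} + if T.b₂.2 = 0 then 0 else 1 := by
    have a1 := card_filter_add_card_filter_not (s := T.Γ₃.cells) (fun c => c.2 = 0)
    have a2 : #T.Γ₃.cells = n + 2 := by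
      rw [T.cells₃, card_insert_of_notMem hn, flag_card T]
    have a3 : #{c ∈ T.Γ₃.cells | ¬ c.2 = 0}
        = #{c ∈ T.Γ₂.cells | c.2 ≠ 0} + if T.b₂.2 = 0 then 0 else 1 := by
      rw [T.cells₃, filter_insert]
      by_cases h : T.b₂.2 = 0
      · simp [h]
      · rw [if_pos h, if_neg h, card_insert_of_notMem (fun h' => hn (mem_filter.1 h').1)]
    rw [ell, ← a3]
    omega
  have hd : (T.b₁.2 + 2 ≤ T.b₂.2) ↔ kInf (shiftB T.b₁) < kInf T.b₂ := by
    rw [kInf_lt]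
    simp only [shiftB]
    constructor
    · intro h; left; omega
    · rintro (h | ⟨h, h'⟩)
      · omega
      · exfalso
        have ha := ((mem_addS (low_cells T.Γ₂)).1 (flag_add T)).2.2
        have hb := (mem_remS.1 (flag_rem T)).2.1
        rcases ha with ha | ha
        · omega
        · exact hb (low_cells T.Γ₂ _ _ _ _ ha (by omega) (by omega))
  change _ = #{c ∈ T.Γ₂.cells | c.2 ≠ 0} + 0 + (if T.b₂.2 = 0 then 0 else 1)
      + if kInf (shiftB T.b₁) < kInf T.b₂ then 1 else 0
  rw [posInf, h1]
  simp only [add_zero]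
  by_cases h : T.b₁.2 + 2 ≤ T.b₂.2
  · rw [if_pos h, if_pos (hd.1 h)]
  · rw [if_neg h, if_neg (fun h' => h (hd.2 h')), add_zero]

end Helpers

/-- The distribution of `pos_∞` on triples `⊢ [n,n+1,n+2]` coincides with that of
`pos_{1+}`. -/
theorem statement4 (n k : ℕ) :
    Nat.card {T : TripleFlag n // posInf T = k}
      = Nat.card {T : TripleFlag n // posOne T.Γ₁.cells T.Γ₂.cells T.b₁ T.b₂ = k} := by
  rw [flag_count n k _ sysInf posInf_eq, flag_count n k _ sysOne posOne_eq]
  have h1 := count_coeff n k sysInf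
  have h2 := count_coeff n k sysOne
  rw [total_unique sysInf sysOne, ← h2] at h1
  exact_mod_cast h1
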